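/- With f_{k,l}(N) := I_q(1; {q^{−N−l}}^k, {q^k}^l; q^{−N}) ∈ ℚ(q) as above, for all k,l ≥ 1 and N ≥ 0 the rational function f_{k,l}(N) satisfies f_{k,l}(N)|_{q ↦ 1/q} = (−1)^{k+l} f_{k,l}(N); i.e., f_{k,l}(N) is invariant (resp. anti-invariant) under q ↦ q^{−1} according as k+l is even (resp. odd). -/

import Mathlib

/-- `f_{k,l}(N)` evaluated at a field element `q`:
`f_{k,l}(N) = I_q(1; {q^{−N−l}}^k, {q^k}^l; q^{−N})`, the sum over chains
`1 ⊴ t_1 ⊴ ⋯ ⊴ t_{k+l} ⊴ q^{−N}` (i.e. `t_j = q^{−n_j}`, `0 ≤ n_1 ≤ ⋯ ≤ n_{k+l} ≤ N`)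
of `∏_{j≤k} t_j/(t_j − q^{−N−l}) · ∏_{j>k} t_j/(t_j − q^k)`. -/
noncomputable def fkl {K : Type*} [Field K] (q : K) (k l N : ℕ) : K :=
  ∑ n ∈ Finset.univ.filter (fun n : Fin (k + l) → Fin (N + 1) =>
      ∀ i j : Fin (k + l), i ≤ j → n i ≤ n j),
    ∏ j : Fin (k + l),
      q ^ (-((n j : ℕ) : ℤ)) /
        (q ^ (-((n j : ℕ) : ℤ)) -
          (if (j : ℕ) < k then q ^ (-((N : ℤ) + (l : ℤ))) else q ^ (k : ℤ)))

section IntervalSums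

open Finset

variable {K : Type*} [Field K]

/-- The complete homogeneous symmetric polynomial of degree `k` in the values `u c`,
`a ≤ c ≤ b`. -/
noncomputable def intervalHsum (u : ℤ → K) : ℕ → ℤ → ℤ → K
  | 0, _, _ => 1
  | k + 1, a, b => ∑ c ∈ Icc a b, u c * intervalHsum u k c b

lemma intervalHsum_zero (u : ℤ → K) (a b : ℤ) : intervalHsum u 0 a b = 1 := rfl

lemma intervalHsum_succ (u : ℤ → K) (k : ℕ) (a b : ℤ) :
    intervalHsum u (k + 1) a b = ∑ c ∈ Icc a b, u c * intervalHsum u k c b := rfl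

lemma intervalHsum_succ_of_lt (u : ℤ → K) (k : ℕ) {a b : ℤ} (h : b < a) :
    intervalHsum u (k + 1) a b = 0 := by
  rw [intervalHsum_succ, Icc_eq_empty (by omega), sum_empty]

lemma intervalHsum_succ' (u : ℤ → K) (k : ℕ) (a b : ℤ) :
    intervalHsum u (k + 1) a b = ∑ c ∈ Icc a b, u c * intervalHsum u k a c := by
  induction k generalizing a b with
  | zero => simp [intervalHsum]
  | succ k ih =>
    rw [intervalHsum_succ]
    simp_rw [ih _ b, intervalHsum_succ u k a, mul_sum]
    rw [sum_comm' (t' := Icc a b) (s' := fun e => Icc a e)]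
    · exact sum_congr rfl fun e _ => sum_congr rfl fun c _ => by ring
    · intro x y
      simp only [mem_Icc]
      omega

lemma sum_Icc_int_top {f : ℤ → K} {a b : ℤ} (h : a ≤ b) :
    ∑ c ∈ Icc a b, f c = ∑ c ∈ Icc a (b - 1), f c + f b := by
  have : Icc a b = insert b (Icc a (b - 1)) := by
    ext x
    simp only [mem_Icc, mem_insert]
    omega
  rw [this, sum_insert (by simp), add_comm]

lemma intervalHsum_succ_top (u : ℤ → K) (k : ℕ) {a b : ℤ} (h : a ≤ b) :
    intervalHsum u (k + 1) a b =
      intervalHsum u (k + 1) a (b - 1) + u b * intervalHsum u k a b := by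
  rw [intervalHsum_succ' u k a b, sum_Icc_int_top h, ← intervalHsum_succ']

lemma intervalHsum_neg (u : ℤ → K) (k : ℕ) (a b : ℤ) :
    intervalHsum (fun c => -u c) k a b = (-1) ^ k * intervalHsum u k a b := by
  induction k generalizing a with
  | zero => simp [intervalHsum]
  | succ k ih =>
    simp_rw [intervalHsum_succ, ih, mul_sum]
    exact sum_congr rfl fun c _ => by ring

lemma sum_Icc_int_add (f : ℤ → K) (s a b : ℤ) :
    ∑ n ∈ Icc a b, f (n + s) = ∑ c ∈ Icc (a + s) (b + s), f c := by
  refine sum_nbij' (fun n => n + s) (fun c => c - s) ?_ ?_ ?_ ?_ ?_ <;>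
    simp only [mem_Icc] <;> intros <;> first | omega | trivial

lemma sum_Icc_int_sub (f : ℤ → K) (s a b : ℤ) :
    ∑ n ∈ Icc a b, f (s - n) = ∑ c ∈ Icc (s - b) (s - a), f c := by
  refine sum_nbij' (fun n => s - n) (fun c => s - c) ?_ ?_ ?_ ?_ ?_ <;>
    simp only [mem_Icc] <;> intros <;> first | omega | trivial

lemma intervalHsum_add (u : ℤ → K) (s : ℤ) (k : ℕ) (a b : ℤ) :
    intervalHsum (fun n => u (n + s)) k a b = intervalHsum u k (a + s) (b + s) := by
  induction k generalizing a with
  | zero => rfl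
  | succ k ih =>
    simp_rw [intervalHsum_succ, ih]
    exact sum_Icc_int_add (fun c => u c * intervalHsum u k c (b + s)) s a b

lemma intervalHsum_sub (u : ℤ → K) (s : ℤ) (k : ℕ) (a b : ℤ) :
    intervalHsum (fun n => u (s - n)) k a b = intervalHsum u k (s - b) (s - a) := by
  induction k generalizing a with
  | zero => rfl
  | succ k ih =>
    rw [intervalHsum_succ, intervalHsum_succ']
    simp_rw [ih]
    exact sum_Icc_int_sub (fun c => u c * intervalHsum u k (s - b) c) s a b

/-- The sum of `∏ u (c i) * ∏ v (d j)` over multisets `c` in `[1, a]` and `d` in `[1, b]` of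
sizes `k + 1` and `l + 1` such that `M ≤ min c + min d`. -/
noncomputable def pairSum (u v : ℤ → K) (M : ℤ) (k l : ℕ) (a b : ℤ) : K :=
  ∑ c ∈ Icc 1 a, ∑ d ∈ Icc 1 b,
    if M ≤ c + d then u c * v d * intervalHsum u k c a * intervalHsum v l d b else 0

/-- The part of `pairSum` in which `min c + min d` is exactly `m`. -/
noncomputable def pairDiag (u v : ℤ → K) (m : ℤ) (k l : ℕ) (a b : ℤ) : K :=
  ∑ c ∈ Icc 1 a, ∑ d ∈ Icc 1 b,
    if c + d = m then u c * v d * intervalHsum u k c a * intervalHsum v l d b else 0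

lemma pairSum_comm (u v : ℤ → K) (M : ℤ) (k l : ℕ) (a b : ℤ) :
    pairSum u v M k l a b = pairSum v u M l k b a := by
  rw [pairSum, sum_comm, pairSum]
  refine sum_congr rfl fun d _ => sum_congr rfl fun c _ => ?_
  rw [add_comm c d]
  split_ifs
  · ring
  · rfl

lemma pairSum_eq_add_pairDiag (u v : ℤ → K) (m : ℤ) (k l : ℕ) (a b : ℤ) :
    pairSum u v m k l a b = pairSum u v (m + 1) k l a b + pairDiag u v m k l a b := by
  simp_rw [pairSum, pairDiag, ← sum_add_distrib]
  refine sum_congr rfl fun c _ => sum_congr rfl fun d _ => ?_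
  split_ifs <;> first | omega | simp

lemma pairSum_succ_left (u v : ℤ → K) (M : ℤ) (k l : ℕ) (a b : ℤ) :
    pairSum u v M (k + 1) l a b =
      pairSum u v M (k + 1) l (a - 1) b + u a * pairSum u v M k l a b := by
  have hsub : pairSum u v M (k + 1) l (a - 1) b = ∑ c ∈ Icc 1 a, ∑ d ∈ Icc 1 b,
      if M ≤ c + d then
        u c * v d * intervalHsum u (k + 1) c (a - 1) * intervalHsum v l d b else 0 := by
    refine sum_subset (Icc_subset_Icc_right (by omega)) fun c hc hc' => ?_
    simp only [mem_Icc] at hc hc'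
    rw [intervalHsum_succ_of_lt u k (by omega)]
    simp
  rw [hsub]
  simp_rw [pairSum, mul_sum, ← sum_add_distrib]
  refine sum_congr rfl fun c hc => sum_congr rfl fun d _ => ?_
  rw [intervalHsum_succ_top u k (mem_Icc.1 hc).2]
  split_ifs
  · ring
  · simp

lemma pairSum_succ_right (u v : ℤ → K) (M : ℤ) (k l : ℕ) (a b : ℤ) :
    pairSum u v M k (l + 1) a b =
      pairSum u v M k (l + 1) a (b - 1) + v b * pairSum u v M k l a b := by
  simp_rw [pairSum_comm u v]
  exact pairSum_succ_left v u M l k b a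

lemma diag_sum_left (u v : ℤ → K) {m : ℤ} (k l : ℕ) {a : ℤ} (b : ℤ) (ha : a < m) :
    (∑ c ∈ Icc 1 a, ∑ d ∈ Icc 1 b, if c + d = m then
      u c * intervalHsum u k c a * intervalHsum v (l + 1) d b else 0) =
      pairSum u v m k l a b := by
  refine sum_congr rfl fun c hc => ?_
  rw [mem_Icc] at hc
  have h₁ : (∑ d ∈ Icc 1 b, if c + d = m then
      u c * intervalHsum u k c a * intervalHsum v (l + 1) d b else 0) =
      u c * intervalHsum u k c a * intervalHsum v (l + 1) (m - c) b := by
    by_cases h : m - c ≤ b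
    · rw [sum_eq_single_of_mem (m - c) (mem_Icc.2 ⟨by omega, h⟩)]
      · rw [if_pos (by omega)]
      · intro d _ hd
        rw [if_neg (by omega)]
    · rw [intervalHsum_succ_of_lt v l (by omega), mul_zero]
      refine sum_eq_zero fun d hd => ?_
      rw [mem_Icc] at hd
      rw [if_neg (by omega)]
  rw [h₁, intervalHsum_succ, mul_sum, ← sum_filter]
  refine sum_congr ?_ fun d _ => by ring
  ext d
  simp only [mem_Icc, mem_filter]
  omega

lemma diag_sum_right (u v : ℤ → K) {m : ℤ} (k l : ℕ) (a : ℤ) {b : ℤ} (hb : b < m) :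
    (∑ c ∈ Icc 1 a, ∑ d ∈ Icc 1 b, if c + d = m then
      v d * intervalHsum u (k + 1) c a * intervalHsum v l d b else 0) =
      pairSum u v m k l a b := by
  rw [pairSum_comm, ← diag_sum_left v u l k a hb, sum_comm]
  refine sum_congr rfl fun d _ => sum_congr rfl fun c _ => ?_
  rw [add_comm c d]
  split_ifs
  · ring
  · rfl

/-- The partial fraction relation satisfied by `u c = q ^ c / (1 - q ^ c)` and
`v c = 1 / (1 - q ^ c)`. -/
def PartialFractionRel (u v : ℤ → K) : Prop :=
  ∀ c d : ℤ, 1 ≤ c → 1 ≤ d → u c * v d = v (c + d) * u c + u (c + d) * v d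

lemma PartialFractionRel.symm {u v : ℤ → K} (h : PartialFractionRel u v) :
    PartialFractionRel v u := fun c d hc hd => by
  rw [mul_comm, h d c hd hc, add_comm d c]
  ring

lemma PartialFractionRel.pairDiag_eq {u v : ℤ → K} (h : PartialFractionRel u v) (m : ℤ)
    (k l : ℕ) (a b : ℤ) :
    pairDiag u v m k l a b =
      v m * (∑ c ∈ Icc 1 a, ∑ d ∈ Icc 1 b, if c + d = m then
        u c * intervalHsum u k c a * intervalHsum v l d b else 0) +
      u m * (∑ c ∈ Icc 1 a, ∑ d ∈ Icc 1 b, if c + d = m then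
        v d * intervalHsum u k c a * intervalHsum v l d b else 0) := by
  simp_rw [pairDiag, mul_sum, ← sum_add_distrib]
  refine sum_congr rfl fun c hc => sum_congr rfl fun d hd => ?_
  split_ifs with hm
  · rw [h c d (mem_Icc.1 hc).1 (mem_Icc.1 hd).1, hm]
    ring
  · simp

lemma PartialFractionRel.pairSum_succ_succ {u v : ℤ → K} (h : PartialFractionRel u v)
    {m : ℤ} (k l : ℕ) {a b : ℤ} (ha : a < m) (hb : b < m) :
    pairSum u v (m + 1) (k + 1) (l + 1) a b =
      pairSum u v m (k + 1) (l + 1) (a - 1) (b - 1) +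
      (u a - u m) * pairSum u v m k (l + 1) a (b - 1) +
      (v b - v m) * pairSum u v m (k + 1) l (a - 1) b +
      (u a * v b - v m * u a - u m * v b) * pairSum u v m k l a b := by
  have e₁ := pairSum_eq_add_pairDiag u v m (k + 1) (l + 1) a b
  have e₂ := h.pairDiag_eq m (k + 1) (l + 1) a b
  rw [diag_sum_left u v (k + 1) l b ha, diag_sum_right u v k (l + 1) a hb] at e₂
  have e₃ := pairSum_succ_left u v m k (l + 1) a b
  have e₄ := pairSum_succ_right u v m (k + 1) l (a - 1) b
  have e₅ := pairSum_succ_right u v m k l a b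
  have e₆ := pairSum_succ_left u v m k l a b
  linear_combination -e₁ - e₂ + e₃ + e₄ + (u a - u m) * e₅ - v m * e₆

lemma PartialFractionRel.pairSum_zero_succ {u v : ℤ → K} (h : PartialFractionRel u v)
    {m : ℤ} (l : ℕ) {b : ℤ} (hm : 1 ≤ m) (hb : b < m) :
    pairSum u v (m + 1) 0 (l + 1) m b =
      pairSum u v m 0 (l + 1) (m - 1) (b - 1) +
      (v b - v m) * pairSum u v m 0 l (m - 1) b := by
  have e₀ : pairSum u v (m + 1) 0 (l + 1) m b =
      pairSum u v (m + 1) 0 (l + 1) (m - 1) b + u m * intervalHsum v (l + 2) 1 b := by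
    rw [pairSum, sum_Icc_int_top hm, pairSum]
    simp_rw [intervalHsum_zero]
    congr 1
    rw [intervalHsum_succ, mul_sum]
    refine sum_congr rfl fun d hd => ?_
    rw [mem_Icc] at hd
    rw [if_pos (by omega)]
    ring
  have e₁ := pairSum_eq_add_pairDiag u v m 0 (l + 1) (m - 1) b
  have e₂ := h.pairDiag_eq m 0 (l + 1) (m - 1) b
  have e₃ : (∑ c ∈ Icc 1 (m - 1), ∑ d ∈ Icc 1 b, if c + d = m then
      v d * intervalHsum u 0 c (m - 1) * intervalHsum v (l + 1) d b else 0) =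
      intervalHsum v (l + 2) 1 b := by
    rw [sum_comm, intervalHsum_succ]
    refine sum_congr rfl fun d hd => ?_
    rw [mem_Icc] at hd
    rw [sum_eq_single_of_mem (m - d) (mem_Icc.2 ⟨by omega, by omega⟩)]
    · rw [if_pos (by omega), intervalHsum_zero, mul_one]
    · intro c _ hc
      rw [if_neg (by omega)]
  rw [diag_sum_left u v 0 l b (by omega), e₃] at e₂
  have e₄ := pairSum_succ_right u v m 0 l (m - 1) b
  linear_combination e₀ - e₁ - e₂ + e₄

lemma pairSum_of_left_lt (u v : ℤ → K) (M : ℤ) (k l : ℕ) {a : ℤ} (b : ℤ) (ha : a < 1) :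
    pairSum u v M k l a b = 0 := by
  rw [pairSum, Icc_eq_empty (by omega), sum_empty]

lemma pairSum_of_right_lt (u v : ℤ → K) (M : ℤ) (k l : ℕ) (a : ℤ) {b : ℤ} (hb : b < 1) :
    pairSum u v M k l a b = 0 := by
  rw [pairSum_comm, pairSum_of_left_lt _ _ _ _ _ _ hb]

lemma PartialFractionRel.pairSum_swap_zero_succ {u v : ℤ → K} (h : PartialFractionRel u v)
    (huv : ∀ c, 1 ≤ c → v c = u c + 1) {m : ℤ} (l : ℕ) {b : ℤ} (hb : b < m)
    (h₁ : pairSum u v m 0 (l + 1) (m - 1) (b - 1) = pairSum v u m 0 (l + 1) (m - 1) (b - 1))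
    (h₂ : pairSum u v m 0 l (m - 1) b = pairSum v u m 0 l (m - 1) b) :
    pairSum u v (m + 1) 0 (l + 1) m b = pairSum v u (m + 1) 0 (l + 1) m b := by
  by_cases hb' : b < 1
  · simp_rw [pairSum_of_right_lt _ _ _ _ _ _ hb']
  · rw [h.pairSum_zero_succ l (by omega) hb, h.symm.pairSum_zero_succ l (by omega) hb, h₁, h₂,
      huv b (by omega), huv m (by omega)]
    ring

/-- The symmetry of `pairSum` under exchanging the two weights. -/
theorem PartialFractionRel.pairSum_swap {u v : ℤ → K} (h : PartialFractionRel u v)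
    (huv : ∀ c, 1 ≤ c → v c = u c + 1) (n k l : ℕ) :
    pairSum u v n k l (n - k - 1) (n - l - 1) = pairSum v u n k l (n - k - 1) (n - l - 1) := by
  induction n generalizing k l with
  | zero => simp_rw [pairSum_of_left_lt _ _ _ _ _ _ (show ((0 : ℕ) : ℤ) - k - 1 < 1 by omega)]
  | succ n ih =>
    have hzero : ∀ l : ℕ, pairSum u v (n + 1) 0 (l + 1) n (n - l - 1) =
        pairSum v u (n + 1) 0 (l + 1) n (n - l - 1) := fun l => by
      refine h.pairSum_swap_zero_succ huv l (by omega) ?_ ?_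
      · convert ih 0 (l + 1) using 2 <;> push_cast <;> ring
      · convert ih 0 l using 2 <;> push_cast <;> ring
    have hcast : ∀ j : ℕ, ((n + 1 : ℕ) : ℤ) - (j + 1 : ℕ) - 1 = n - j - 1 := fun j => by
      push_cast; ring
    have hcast₀ : ((n + 1 : ℕ) : ℤ) - (0 : ℕ) - 1 = n := by push_cast; ring
    rcases k with _ | k <;> rcases l with _ | l
    · exact pairSum_comm ..
    · rw [hcast, hcast₀]
      exact_mod_cast hzero l
    · rw [hcast, hcast₀]
      push_cast
      exact (pairSum_comm ..).trans ((hzero k).symm.trans (pairSum_comm ..))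
    · rw [hcast, hcast]
      push_cast
      by_cases ha : (n : ℤ) - k - 1 < 1
      · simp_rw [pairSum_of_left_lt _ _ _ _ _ _ ha]
      by_cases hb : (n : ℤ) - l - 1 < 1
      · simp_rw [pairSum_of_right_lt _ _ _ _ _ _ hb]
      have h₁ := ih (k + 1) (l + 1)
      have h₂ := ih k (l + 1)
      have h₃ := ih (k + 1) l
      have h₄ := ih k l
      have hsub : ∀ j : ℕ, (n : ℤ) - (j + 1 : ℕ) - 1 = n - j - 1 - 1 := fun j => by
        push_cast; ring
      rw [hsub, hsub] at h₁
      rw [hsub] at h₂ h₃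
      rw [h.pairSum_succ_succ k l (by omega) (by omega),
        h.symm.pairSum_succ_succ k l (by omega) (by omega), h₁, h₂, h₃, h₄,
        huv n (by omega), huv _ (not_lt.1 ha), huv _ (not_lt.1 hb)]
      ring

lemma pairSum_neg_left (u v : ℤ → K) (M : ℤ) (k l : ℕ) (a b : ℤ) :
    pairSum (fun c => -u c) v M k l a b = (-1) ^ (k + 1) * pairSum u v M k l a b := by
  simp_rw [pairSum, mul_sum, intervalHsum_neg]
  refine sum_congr rfl fun c _ => sum_congr rfl fun d _ => ?_
  split_ifs
  · ring
  · simp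

/-- The sum of `∏ j < p, g j (n j)` over chains `a ≤ n 0 ≤ ⋯ ≤ n (p - 1) ≤ N`. -/
noncomputable def chainSum (N : ℤ) : ℕ → (ℕ → ℤ → K) → ℤ → K
  | 0, _, _ => 1
  | p + 1, g, a => ∑ n ∈ Icc a N, g 0 n * chainSum N p (fun j => g (j + 1)) n

lemma chainSum_const (N : ℤ) (p : ℕ) (w : ℤ → K) (a : ℤ) :
    chainSum N p (fun _ => w) a = intervalHsum w p a N := by
  induction p generalizing a with
  | zero => rfl
  | succ p ih => simp_rw [chainSum, intervalHsum_succ, ih]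

lemma chainSum_two_blocks (N : ℤ) (k l : ℕ) (A B : ℤ → K) (a : ℤ) :
    chainSum N (k + 1 + (l + 1)) (fun j => if j < k + 1 then A else B) a =
      ∑ n ∈ Icc a N, ∑ m ∈ Icc n N,
        A n * B m * intervalHsum A k a n * intervalHsum B l m N := by
  induction k generalizing a with
  | zero =>
    rw [show 0 + 1 + (l + 1) = (l + 1) + 1 by ring, chainSum]
    refine sum_congr rfl fun n _ => ?_
    simp only [zero_add, Nat.lt_one_iff, if_true, Nat.add_eq_zero_iff, one_ne_zero, and_false,
      if_false, chainSum_const, intervalHsum_succ, intervalHsum_zero, mul_sum]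
    exact sum_congr rfl fun m _ => by ring
  | succ k ih =>
    rw [show k + 1 + 1 + (l + 1) = (k + 1 + (l + 1)) + 1 by ring, chainSum]
    simp only [add_lt_add_iff_right, Nat.zero_lt_succ, if_true]
    simp_rw [ih, intervalHsum_succ A k, mul_sum]
    rw [sum_comm' (t' := Icc a N) (s' := fun n => Icc a n)]
    · refine sum_congr rfl fun n _ => ?_
      rw [sum_comm]
      refine sum_congr rfl fun m _ => ?_
      rw [sum_mul]
      exact sum_congr rfl fun c _ => by ring
    · intro x y
      simp only [mem_Icc]
      omega

lemma sum_fin_ite_le (N a : ℕ) (F : ℤ → K) :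
    (∑ x : Fin (N + 1), if a ≤ (x : ℕ) then F (x : ℕ) else 0) = ∑ c ∈ Icc (a : ℤ) N, F c := by
  rw [← sum_filter]
  refine sum_bij (fun x _ => ((x : ℕ) : ℤ)) ?_ ?_ ?_ ?_
  · intro x hx
    simp only [mem_filter, mem_univ, true_and] at hx
    rw [mem_Icc]
    omega
  · intro x _ y _ hxy
    exact Fin.ext (by exact_mod_cast hxy)
  · intro c hc
    rw [mem_Icc] at hc
    refine ⟨⟨c.toNat, by omega⟩, ?_, ?_⟩
    · simp only [mem_filter, mem_univ, true_and]
      omega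
    · simp only
      omega
  · intros
    rfl

lemma sum_monotone_eq_chainSum (N p : ℕ) (g : ℕ → ℤ → K) (a : ℕ) :
    (∑ n : Fin p → Fin (N + 1),
      if (∀ i j, i ≤ j → n i ≤ n j) ∧ ∀ i, a ≤ (n i : ℕ) then
        ∏ j : Fin p, g j ((n j : ℕ) : ℤ) else 0) = chainSum N p g a := by
  induction p generalizing g a with
  | zero => simp [chainSum]
  | succ p ih =>
    rw [chainSum, ← sum_fin_ite_le N a
        (fun n => g 0 n * chainSum N p (fun j => g (j + 1)) n),
      ← (Fin.consEquiv (fun _ => Fin (N + 1))).sum_comp, Fintype.sum_prod_type]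
    refine sum_congr rfl fun x _ => ?_
    rw [← ih, mul_sum]
    have hiff : ∀ n : Fin p → Fin (N + 1),
        ((∀ i j, i ≤ j → (Fin.cons x n : Fin (p + 1) → Fin (N + 1)) i ≤
            (Fin.cons x n : Fin (p + 1) → Fin (N + 1)) j) ∧
          ∀ i, a ≤ ((Fin.cons x n : Fin (p + 1) → Fin (N + 1)) i : ℕ)) ↔
        a ≤ (x : ℕ) ∧ (∀ i j, i ≤ j → n i ≤ n j) ∧ ∀ i, (x : ℕ) ≤ (n i : ℕ) := fun n => by
      simp only [Fin.forall_fin_succ, Fin.cons_zero, Fin.cons_succ, Fin.succ_le_succ_iff,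
        Fin.zero_le, forall_const, le_refl, true_and]
      constructor
      · rintro ⟨⟨h₁, h₂⟩, h₃, h₄⟩
        exact ⟨h₃, fun i j hij => (h₂ i).2 j hij, h₁⟩
      · rintro ⟨h₁, h₂, h₃⟩
        exact ⟨⟨h₃, fun i => ⟨fun hi => absurd hi (Fin.succ_pos i).not_ge, h₂ i⟩⟩, h₁, fun i => h₁.trans (h₃ i)⟩
    by_cases hx : a ≤ (x : ℕ)
    · rw [if_pos hx]
      refine sum_congr rfl fun n _ => ?_
      simp only [Fin.consEquiv_apply, hiff, hx, true_and, Fin.prod_univ_succ, Fin.cons_zero,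
        Fin.cons_succ, Fin.val_zero, Fin.val_succ, mul_ite, mul_zero]
    · rw [if_neg hx]
      refine sum_eq_zero fun n _ => ?_
      simp only [Fin.consEquiv_apply, hiff, hx, false_and, if_false]

lemma two_blocks_eq_pairSum (N k l : ℕ) (α β : ℤ → K) :
    (∑ n ∈ Icc (0 : ℤ) N, ∑ m ∈ Icc n (N : ℤ),
      α (N + l + 1 - n) * β (m + (k + 1)) *
        intervalHsum (fun n => α (N + l + 1 - n)) k 0 n *
        intervalHsum (fun m => β (m + (k + 1))) l m N) =
      pairSum α β (N + k + l + 2) k l (N + l + 1) (N + k + 1) := by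
  simp_rw [intervalHsum_sub α, intervalHsum_add β, sub_zero]
  have inner : ∀ n : ℤ, (∑ m ∈ Icc n (N : ℤ),
      α (N + l + 1 - n) * β (m + (k + 1)) * intervalHsum α k (N + l + 1 - n) (N + l + 1) *
        intervalHsum β l (m + (k + 1)) (N + (k + 1))) =
      ∑ d ∈ Icc (N + k + l + 2 - (N + l + 1 - n)) (N + k + 1 : ℤ),
        α (N + l + 1 - n) * β d * intervalHsum α k (N + l + 1 - n) (N + l + 1) *
          intervalHsum β l d (N + k + 1) := fun n => by
    rw [sum_Icc_int_add (fun d => α (N + l + 1 - n) * β d *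
      intervalHsum α k (N + l + 1 - n) (N + l + 1) * intervalHsum β l d (N + (k + 1))),
      show (N + k + l + 2 - (N + l + 1 - n) : ℤ) = n + (k + 1) by ring,
      add_assoc (N : ℤ) (k : ℤ) 1]
  simp_rw [inner]
  rw [sum_Icc_int_sub (fun c => ∑ d ∈ Icc (N + k + l + 2 - c) (N + k + 1 : ℤ),
    α c * β d * intervalHsum α k c (N + l + 1) * intervalHsum β l d (N + k + 1)), pairSum]
  rw [sum_subset (s₂ := Icc (1 : ℤ) (N + l + 1))]
  · refine sum_congr rfl fun c hc => ?_
    rw [mem_Icc] at hc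
    rw [← sum_filter]
    refine sum_congr ?_ fun _ _ => rfl
    ext d
    simp only [mem_Icc, mem_filter]
    omega
  · intro c
    simp only [mem_Icc]
    omega
  · intro c hc hc'
    simp only [mem_Icc] at hc hc'
    rw [Icc_eq_empty (by omega), sum_empty]

theorem fkl_eq_pairSum {q : K} (hq : q ≠ 0) (k l N : ℕ) :
    fkl q (k + 1) (l + 1) N =
      pairSum (fun c => (1 - q ^ (-c))⁻¹) (fun d => (1 - q ^ d)⁻¹) (N + k + l + 2) k l
        (N + l + 1) (N + k + 1) := by
  have hterm : ∀ n e : ℤ, q ^ (-n) / (q ^ (-n) - q ^ e) = (1 - q ^ (n + e))⁻¹ := fun n e => by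
    have hn : q ^ (-n) ≠ 0 := zpow_ne_zero _ hq
    rw [show q ^ e = q ^ (-n) * q ^ (n + e) by rw [← zpow_add₀ hq]; congr 1; ring,
      show q ^ (-n) - q ^ (-n) * q ^ (n + e) = q ^ (-n) * (1 - q ^ (n + e)) by ring,
      div_mul_eq_div_div, div_self hn, one_div]
  rw [← two_blocks_eq_pairSum, ← chainSum_two_blocks]
  have h := sum_monotone_eq_chainSum N (k + 1 + (l + 1)) (fun j => if j < k + 1 then
    (fun n : ℤ => (1 - q ^ (-(N + l + 1 - n)))⁻¹) else fun m : ℤ => (1 - q ^ (m + (k + 1)))⁻¹) 0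
  rw [Nat.cast_zero] at h
  rw [← h, fkl, sum_filter]
  refine sum_congr rfl fun n _ => ?_
  simp only [Nat.zero_le, forall_const, and_true]
  refine if_congr Iff.rfl (prod_congr rfl fun j _ => ?_) rfl
  split_ifs <;> rw [hterm] <;> push_cast <;> ring_nf

/-- The symmetry of `fkl` under `q ↦ q⁻¹`, at any `q` that is not a root of unity. -/
theorem fkl_inv {q : K} (hq : q ≠ 0) (hq' : ∀ c : ℤ, 1 ≤ c → q ^ c ≠ 1) (k l N : ℕ) :
    fkl q⁻¹ (k + 1) (l + 1) N = (-1) ^ (k + 1 + (l + 1)) * fkl q (k + 1) (l + 1) N := by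
  set u : ℤ → K := fun c => q ^ c / (1 - q ^ c) with hu
  set v : ℤ → K := fun c => (1 - q ^ c)⁻¹ with hv
  have hne : ∀ c : ℤ, 1 ≤ c → 1 - q ^ c ≠ 0 := fun c hc => sub_ne_zero.2 (hq' c hc).symm
  have hneg : (fun c : ℤ => (1 - q ^ (-c))⁻¹) = fun c => -u c := by
    funext c
    have hc : q ^ c ≠ 0 := zpow_ne_zero _ hq
    rw [zpow_neg, show 1 - (q ^ c)⁻¹ = -((1 - q ^ c) / q ^ c) by field_simp; ring, inv_neg,
      inv_div]
  have hrel : PartialFractionRel u v := fun c d hc hd => by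
    have h₁ := hne c hc
    have h₂ := hne d hd
    have h₃ := hne (c + d) (by omega)
    simp only [hu, hv]
    rw [zpow_add₀ hq] at h₃ ⊢
    field_simp
    ring
  have huv : ∀ c, 1 ≤ c → v c = u c + 1 := fun c hc => by
    have := hne c hc
    simp only [hu, hv]
    field_simp
    ring
  have hswap := hrel.pairSum_swap huv (N + k + l + 2) k l
  rw [show ((N + k + l + 2 : ℕ) : ℤ) - k - 1 = N + l + 1 by push_cast; ring,
    show ((N + k + l + 2 : ℕ) : ℤ) - l - 1 = N + k + 1 by push_cast; ring] at hswap
  push_cast at hswap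
  rw [fkl_eq_pairSum (inv_ne_zero hq), fkl_eq_pairSum hq]
  simp only [inv_zpow', neg_neg]
  rw [hneg, pairSum_neg_left, hswap, pairSum_comm v, pairSum_neg_left, pairSum_comm u]
  have hsq : ((-1 : K) ^ (k + 1)) * (-1) ^ (k + 1) = 1 := by rw [← mul_pow]; simp
  linear_combination (-(-1) ^ (l + 1) *
    pairSum v u (N + k + l + 2) k l (N + l + 1) (N + k + 1)) * hsq

end IntervalSums

/-- **Theorem 4.4 of the paper** (the case `w = e_{BD}^k e_{AB}^l`, `B = C = ∞`):
in `ℚ(q)`, `f_{k,l}(N)|_{q ↦ 1/q} = (−1)^{k+l} f_{k,l}(N)`; i.e. `f_{k,l}(N)` is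
invariant (resp. anti-invariant) under `q ↦ q^{−1}` according as `k+l` is even
(resp. odd). -/
theorem fkl_symmetry (k l N : ℕ) (hk : 1 ≤ k) (hl : 1 ≤ l) :
    fkl (RatFunc.X : RatFunc ℚ)⁻¹ k l N
      = (-1 : RatFunc ℚ) ^ (k + l) * fkl (RatFunc.X : RatFunc ℚ) k l N := by
  obtain ⟨k, rfl⟩ := Nat.exists_eq_add_of_le' hk
  obtain ⟨l, rfl⟩ := Nat.exists_eq_add_of_le' hl
  refine fkl_inv RatFunc.X_ne_zero (fun c hc h => ?_) k l N
  lift c to ℕ using by omega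
  rw [zpow_natCast, ← RatFunc.algebraMap_X, ← map_pow, ← map_one (algebraMap (Polynomial ℚ) (RatFunc ℚ))] at h
  have h' := congrArg Polynomial.natDegree (RatFunc.algebraMap_injective ℚ h)
  rw [Polynomial.natDegree_X_pow, Polynomial.natDegree_one] at h'
  omega
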